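/- For every integer N ≥ 2, the point with f1 = m1 = l1 = g1 = 1, c_fl = c_mg = N, c_ba = −2, t = 1 is feasible for the identity-bridge lower-bound problem, its objective value is G = √(N² + 2N) + 2(N−1), and this value is at most 3N − 1; consequently, the optimal value of the identity-bridge lower-bound problem is at most 3N − 1. -/

import Mathlib

/-- The objective `G` of the lower-bound problems:
`G = √((c_fl² + c_mg² + N·c_ba²)/2) + (N−1)·√((f1−m1)² + (g1−l1)² + 4t)`. -/
noncomputable def Gobj (N : ℕ) (f1 g1 l1 m1 cfl cmg cba t : ℝ) : ℝ :=
  Real.sqrt ((cfl ^ 2 + cmg ^ 2 + N * cba ^ 2) / 2) +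
    ((N : ℝ) - 1) * Real.sqrt ((f1 - m1) ^ 2 + (g1 - l1) ^ 2 + 4 * t)

/-- Feasible set of the identity-bridge lower-bound problem. -/
def FeasIdnLB (N : ℕ) (f1 g1 l1 m1 cfl cmg cba t : ℝ) : Prop :=
  1 ≤ f1 ∧ 1 ≤ l1 ∧ 1 ≤ m1 ∧
  ((N : ℝ) - 1) * f1 + cfl + N * cba + N ≤ ((N : ℝ) - 1) * l1 ∧
  ((N : ℝ) - 1) * l1 + N ≤ ((N : ℝ) - 1) * f1 + cfl ∧
  ((N : ℝ) - 1) * g1 + N ≤ ((N : ℝ) - 1) * m1 + cmg ∧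
  -g1 + N ≤ ((N : ℝ) - 1) * m1 + cmg ∧
  f1 * m1 ≤ t ∧
  g1 * l1 ≤ t

/-- The point `f1 = m1 = l1 = g1 = 1`, `c_fl = c_mg = N`,
`c_ba = −2`, `t = 1` is feasible for the identity-bridge lower-bound problem,
its objective value is `√(N² + 2N) + 2(N−1)`, which is at most `3N − 1`;
hence the optimal value of the identity-bridge lower-bound problem is at
most `3N − 1`. -/
theorem identity_bridge_feasible_point (N : ℕ) (hN : 2 ≤ N) :
    FeasIdnLB N 1 1 1 1 (N : ℝ) (N : ℝ) (-2) 1 ∧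
    Gobj N 1 1 1 1 (N : ℝ) (N : ℝ) (-2) 1 =
      Real.sqrt ((N : ℝ) ^ 2 + 2 * N) + 2 * ((N : ℝ) - 1) ∧
    Real.sqrt ((N : ℝ) ^ 2 + 2 * N) + 2 * ((N : ℝ) - 1) ≤ 3 * (N : ℝ) - 1 ∧
    sInf {y : ℝ | ∃ f1 g1 l1 m1 cfl cmg cba t : ℝ,
        FeasIdnLB N f1 g1 l1 m1 cfl cmg cba t ∧
        y = Gobj N f1 g1 l1 m1 cfl cmg cba t} ≤ 3 * (N : ℝ) - 1 := by
  have hN' : (2 : ℝ) ≤ N := by exact_mod_cast hN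
  have hfeas : FeasIdnLB N 1 1 1 1 (N : ℝ) (N : ℝ) (-2) 1 := by
    refine ⟨?_, ?_, ?_, ?_, ?_, ?_, ?_, ?_, ?_⟩ <;> linarith
  have hval : Gobj N 1 1 1 1 (N : ℝ) (N : ℝ) (-2) 1 =
      Real.sqrt ((N : ℝ) ^ 2 + 2 * N) + 2 * ((N : ℝ) - 1) := by
    have hsqrt : Real.sqrt ((1 - 1) ^ 2 + (1 - 1) ^ 2 + 4 * 1) = 2 := by
      rw [Real.sqrt_eq_iff_mul_self_eq] <;> norm_num
    rw [Gobj, hsqrt, mul_comm _ (2 : ℝ)]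
    congr 2
    ring
  have hle : Real.sqrt ((N : ℝ) ^ 2 + 2 * N) + 2 * ((N : ℝ) - 1) ≤ 3 * (N : ℝ) - 1 := by
    have : Real.sqrt ((N : ℝ) ^ 2 + 2 * N) ≤ N + 1 :=
      Real.sqrt_le_iff.mpr ⟨by linarith, by linarith⟩
    linarith
  refine ⟨hfeas, hval, hle, le_trans (csInf_le ⟨0, ?_⟩
    ⟨1, 1, 1, 1, N, N, -2, 1, hfeas, rfl⟩) (hval.trans_le hle)⟩
  rintro y ⟨f1, g1, l1, m1, cfl, cmg, cba, t, -, rfl⟩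
  exact add_nonneg (Real.sqrt_nonneg _) (mul_nonneg (by linarith) (Real.sqrt_nonneg _))
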